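/- Let (x̄,λ̄) be a KKT point of the unperturbed problem (a,b)=(0,0). Then the KKT solution map S_KKT is isolated calm at (0,0) for (x̄,λ̄) if and only if the multiplier set map M is isolated calm at (x̄,0,0) for λ̄ and the multiplier λ̄ is noncritical. -/

import Mathlib

open Set Filter Topology Metric Pointwise
open scoped RealInnerProductSpace Classical

noncomputable section

/-- The normal cone of convex analysis: `N_K(z) = {l | ⟪l, y - z⟫ ≤ 0 ∀ y ∈ K}`,
empty when `z ∉ K`. -/
def nCone {E : Type*} [NormedAddCommGroup E] [InnerProductSpace ℝ E]
    (K : Set E) (z : E) : Set E :=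
  {l | z ∈ K ∧ ∀ y ∈ K, ⟪l, y - z⟫ ≤ 0}

/-- The metric projection onto `K`: under the standing assumptions (`K` nonempty,
closed and convex in a finite-dimensional space) the distance minimizer exists and
is unique, so this choice-based definition is exactly the metric projection `Π_K`. -/

def projK {E : Type*} [NormedAddCommGroup E] [InnerProductSpace ℝ E]
    (K : Set E) (z : E) : E :=
  if h : ∃ p, p ∈ K ∧ ∀ y ∈ K, ‖z - p‖ ≤ ‖z - y‖ then h.choose else 0

/-- A set `D` is a pointed closed convex cone. -/
def PointedClosedConvexCone {E : Type*} [NormedAddCommGroup E] [NormedSpace ℝ E]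
    (D : Set E) : Prop :=
  IsClosed D ∧ Convex ℝ D ∧ (∀ t : ℝ, 0 ≤ t → ∀ z ∈ D, t • z ∈ D) ∧ D ∩ (-D) ⊆ {0}

/-- `K` is `C²`-cone reducible at `y`: near `y`, `K` is the inverse image of a pointed
closed convex cone `D` under a twice continuously differentiable map `Ξ` with `Ξ y = 0`
and `Ξ'(y)` surjective.  (Since the target of the reduction is a finite-dimensional
space of dimension at most `dim Y`, it can be taken to be a Euclidean space.) -/
def C2ConeReducibleAt {Y : Type*} [NormedAddCommGroup Y] [InnerProductSpace ℝ Y]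
    (K : Set Y) (y : Y) : Prop :=
  ∃ (m : ℕ) (U : Set Y) (D : Set (EuclideanSpace ℝ (Fin m)))
    (Ξ : Y → EuclideanSpace ℝ (Fin m)),
      IsOpen U ∧ y ∈ U ∧ PointedClosedConvexCone D ∧ ContDiffOn ℝ 2 Ξ U ∧
      Ξ y = 0 ∧ Function.Surjective (fderiv ℝ Ξ y) ∧ K ∩ U = {y' ∈ U | Ξ y' ∈ D}

/-- `K` is `C²`-cone reducible (at every point of `K`). -/
def C2ConeReducible {Y : Type*} [NormedAddCommGroup Y] [InnerProductSpace ℝ Y]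
    (K : Set Y) : Prop :=
  ∀ y ∈ K, C2ConeReducibleAt K y

/-- Calmness of a set-valued map `F` at `z0` for `w0 ∈ F z0`. -/
def Calm {Z W : Type*} [NormedAddCommGroup Z] [NormedAddCommGroup W]
    (F : Z → Set W) (z0 : Z) (w0 : W) : Prop :=
  ∃ κ ε δ : ℝ, 0 < κ ∧ 0 < ε ∧ 0 < δ ∧
    ∀ z : Z, ‖z - z0‖ ≤ ε → ∀ w ∈ F z, ‖w - w0‖ ≤ δ →
      ∃ w' ∈ F z0, ‖w - w'‖ ≤ κ * ‖z - z0‖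

/-- Isolated calmness of a set-valued map `F` at `z0` for `w0 ∈ F z0`. -/
def IsolatedCalm {Z W : Type*} [NormedAddCommGroup Z] [NormedAddCommGroup W]
    (F : Z → Set W) (z0 : Z) (w0 : W) : Prop :=
  ∃ κ ε δ : ℝ, 0 < κ ∧ 0 < ε ∧ 0 < δ ∧
    ∀ z : Z, ‖z - z0‖ ≤ ε → ∀ w ∈ F z, ‖w - w0‖ ≤ δ →
      ‖w - w0‖ ≤ κ * ‖z - z0‖

/-- Metric subregularity of `F` at `z0` for `w0 ∈ F z0`:
`dist(z, F⁻¹(w0)) ≤ κ · dist(w0, F z ∩ B_δ(w0))` for `z` near `z0`; since the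
right-hand side is an infimum over `F z ∩ B_δ(w0)` (`= +∞` when empty), this is
equivalently stated pointwise. -/
def MetricallySubregular {Z W : Type*} [NormedAddCommGroup Z] [NormedAddCommGroup W]
    (F : Z → Set W) (z0 : Z) (w0 : W) : Prop :=
  ∃ κ ε δ : ℝ, 0 < κ ∧ 0 < ε ∧ 0 < δ ∧
    ∀ z : Z, ‖z - z0‖ ≤ ε → ∀ w ∈ F z, ‖w - w0‖ ≤ δ →
      infDist z {z' : Z | w0 ∈ F z'} ≤ κ * ‖w0 - w‖

/-- `φ` has directional derivative `w` at `z` in direction `h`. -/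
def HasDirDeriv {E : Type*} [NormedAddCommGroup E] [NormedSpace ℝ E]
    (φ : E → E) (z h w : E) : Prop :=
  Tendsto (fun t : ℝ => t⁻¹ • (φ (z + t • h) - φ z)) (𝓝[>] (0 : ℝ)) (𝓝 w)

/-- The contingent (Bouligand) tangent cone to `s` at `z`. -/
def contCone {E : Type*} [NormedAddCommGroup E] [NormedSpace ℝ E]
    (s : Set E) (z : E) : Set E :=
  {w | ∃ (t : ℕ → ℝ) (v : ℕ → E), (∀ n, 0 < t n) ∧ Tendsto t atTop (𝓝 0) ∧
        Tendsto v atTop (𝓝 w) ∧ ∀ n, z + t n • v n ∈ s}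

/-- The negative polar cone of a set. -/
def negPolar {E : Type*} [NormedAddCommGroup E] [InnerProductSpace ℝ E]
    (C : Set E) : Set E :=
  {z | ∀ d ∈ C, ⟪z, d⟫ ≤ 0}

/-- The critical cone `C_K(y,u) = T_K(y) ∩ u^⊥`. -/
def criticalCone {E : Type*} [NormedAddCommGroup E] [InnerProductSpace ℝ E]
    (K : Set E) (y u : E) : Set E :=
  contCone K y ∩ {d | ⟪u, d⟫ = 0}

/-- The (outer) second-order tangent set `T²_K(y,h)`. -/
def secondOrderTangent {E : Type*} [NormedAddCommGroup E] [NormedSpace ℝ E]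
    (K : Set E) (y h : E) : Set E :=
  {w | ∃ (t : ℕ → ℝ) (v : ℕ → E), (∀ n, 0 < t n) ∧ Tendsto t atTop (𝓝 0) ∧
        Tendsto v atTop (𝓝 w) ∧ ∀ n, y + t n • h + ((t n) ^ 2 / 2) • v n ∈ K}

variable {X Y : Type*} [NormedAddCommGroup X] [InnerProductSpace ℝ X]
  [FiniteDimensional ℝ X] [NormedAddCommGroup Y] [InnerProductSpace ℝ Y]
  [FiniteDimensional ℝ Y]

/-- The KKT solution map of the canonically perturbed problem:
`∇f(x) + ∇g(x)*λ = a` and `λ ∈ N_K(g(x) − b)`. -/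
def sKKT (f : X → ℝ) (g : X → Y) (K : Set Y) (a : X) (b : Y) : Set (X × Y) :=
  {p | gradient f p.1 + ContinuousLinearMap.adjoint (fderiv ℝ g p.1) p.2 = a ∧
       p.2 ∈ nCone K (g p.1 - b)}

/-- The multiplier set map `M(x,a,b)`. -/
def mSet (f : X → ℝ) (g : X → Y) (K : Set Y) (x : X) (a : X) (b : Y) : Set Y :=
  {l | (x, l) ∈ sKKT f g K a b}

/-- The stationary point map `X_KKT(a,b)`. -/
def xKKT (f : X → ℝ) (g : X → Y) (K : Set Y) (a : X) (b : Y) : Set X :=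
  {x | ∃ l, (x, l) ∈ sKKT f g K a b}

/-- The Hessian `∇²ₓₓL(x,λ)` of the Lagrangian `L(·,λ)` at `x`. -/
def hessLxx (f : X → ℝ) (g : X → Y) (x : X) (l : Y) : X →L[ℝ] X :=
  fderiv ℝ (fun u => gradient (fun v => f v + ⟪l, g v⟫) u) x

/-- The multiplier `l0` is noncritical: the only solutions `(ξ,v)` of
`∇²ₓₓL(x̄,λ̄)ξ + ∇g(x̄)*v = 0`, `g'(x̄)ξ − Π_K'(g(x̄)+λ̄; g'(x̄)ξ+v) = 0` have `ξ = 0`. -/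
def Noncritical (f : X → ℝ) (g : X → Y) (K : Set Y) (x0 : X) (l0 : Y) : Prop :=
  ∀ (ξ : X) (v : Y),
    hessLxx f g x0 l0 ξ + ContinuousLinearMap.adjoint (fderiv ℝ g x0) v = 0 →
    HasDirDeriv (projK K) (g x0 + l0) (fderiv ℝ g x0 ξ + v) (fderiv ℝ g x0 ξ) →
    ξ = 0

/-- Strong calmness of `S_KKT` at the origin for `(x̄,λ̄)`. -/
def StrongCalm (f : X → ℝ) (g : X → Y) (K : Set Y) (x0 : X) (l0 : Y) : Prop :=
  ∃ δ ε κ : ℝ, 0 < δ ∧ 0 < ε ∧ 0 < κ ∧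
    ∀ (a : X) (b : Y), ‖(a, b)‖ ≤ δ →
      ∀ (x : X) (l : Y), (x, l) ∈ sKKT f g K a b → ‖(x, l) - (x0, l0)‖ ≤ ε →
        ‖x - x0‖ + infDist l (mSet f g K x0 0 0) ≤ κ * ‖(a, b)‖

/-- Pseudo-isolated calmness of `X_KKT` at the origin for `x̄` (relative to `λ̄`). -/
def PseudoIsolatedCalm (f : X → ℝ) (g : X → Y) (K : Set Y) (x0 : X) (l0 : Y) : Prop :=
  ∃ ε δ κ : ℝ, 0 < ε ∧ 0 < δ ∧ 0 < κ ∧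
    ∀ (a : X) (b : Y), ‖(a, b)‖ ≤ δ →
      ∀ (x : X) (l : Y), (x, l) ∈ sKKT f g K a b → ‖(x, l) - (x0, l0)‖ ≤ ε →
        ‖x - x0‖ ≤ κ * ‖(a, b)‖


lemma aux_lim {α E F : Type*} [NormedAddCommGroup E] [NormedSpace ℝ E]
    [NormedAddCommGroup F] [NormedSpace ℝ F] {φ : E → F} {φ' : E →L[ℝ] F} {x : E}
    (h : HasFDerivAt φ φ' x) {l : Filter α} {t : α → ℝ} {u : α → E} {ξ : E}
    (ht : Tendsto t l (𝓝[>] 0)) (hu : Tendsto u l (𝓝 ξ)) :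
    Tendsto (fun n => (t n)⁻¹ • (φ (x + t n • u n) - φ x)) l (𝓝 (φ' ξ)) := by
  have ht0 : Tendsto t l (𝓝 0) := tendsto_nhds_of_tendsto_nhdsWithin ht
  have htp : ∀ᶠ n in l, 0 < t n := (tendsto_nhdsWithin_iff.1 ht).2
  have htu : Tendsto (fun n => x + t n • u n) l (𝓝 x) := by
    simpa using tendsto_const_nhds.add (ht0.smul hu)
  have h1 := h.isLittleO.comp_tendsto htu
  have h2 : Tendsto (fun n => (t n)⁻¹ • (φ (x + t n • u n) - φ x - φ' (t n • u n))) l (𝓝 0) := by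
    have h3 : (fun n => (t n)⁻¹ • (φ (x + t n • u n) - φ x - φ' (t n • u n))) =o[l] u := by
      have h4 := (Asymptotics.isBigO_refl (fun n => (t n)⁻¹) l).smul_isLittleO h1
      refine (h4.congr' ?_ ?_)
      · filter_upwards with n
        simp
      · filter_upwards [htp] with n hn
        simp [smul_smul, hn.ne']
    exact (Asymptotics.isLittleO_one_iff ℝ).1 (h3.trans_isBigO (hu.isBigO_one ℝ))
  have h5 : Tendsto (fun n => φ' (u n)) l (𝓝 (φ' ξ)) := (φ'.continuous.tendsto ξ).comp hu
  have h6 := h2.add h5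
  rw [zero_add] at h6
  refine h6.congr' ?_
  filter_upwards [htp] with n hn
  rw [smul_sub, map_smul, smul_smul, inv_mul_cancel₀ hn.ne', one_smul, sub_add_cancel]

lemma aux_taylor {E : Type*} [NormedAddCommGroup E] [NormedSpace ℝ E] {φ : E → ℝ}
    (h : ContDiffAt ℝ 2 φ 0) {ε : ℝ} (hε : 0 < ε) :
    ∀ᶠ d in 𝓝 (0 : E), |φ d - φ 0 - fderiv ℝ φ 0 d - (1/2) * fderiv ℝ (fderiv ℝ φ) 0 d d|
      ≤ ε * ‖d‖ ^ 2 := by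
  have hd : DifferentiableAt ℝ (fderiv ℝ φ) 0 :=
    (h.fderiv_right (m := 1) (by norm_num)).differentiableAt (by norm_num)
  set B := fderiv ℝ (fderiv ℝ φ) 0 with hB
  have h1 := hd.hasFDerivAt.isLittleO.def hε
  have h2 : ∀ᶠ x in 𝓝 (0 : E), DifferentiableAt ℝ φ x := by
    have := h.eventually (by simp)
    filter_upwards [this] with x hx using hx.differentiableAt (by norm_num)
  obtain ⟨r, hr, hball⟩ := Metric.eventually_nhds_iff_ball.1 (h1.and h2)
  filter_upwards [Metric.ball_mem_nhds (0 : E) hr] with d hdr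
  have hs : ∀ s ∈ Icc (0:ℝ) 1, s • d ∈ ball (0 : E) r := by
    intro s hs
    rw [mem_ball_zero_iff] at hdr ⊢
    rw [norm_smul, Real.norm_eq_abs, abs_of_nonneg hs.1]
    nlinarith [norm_nonneg d, hs.2]
  have key := norm_image_sub_le_of_norm_deriv_le_segment_01'
    (f := fun s : ℝ => φ (s • d) - s * fderiv ℝ φ 0 d - s ^ 2 * ((1/2) * B d d))
    (f' := fun s : ℝ => fderiv ℝ φ (s • d) d - fderiv ℝ φ 0 d - 2 * s * ((1/2) * B d d))
    (C := ε * ‖d‖ ^ 2) ?_ ?_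
  · simp only [one_smul, zero_smul, one_pow, one_mul, zero_mul, sub_zero] at key
    rw [Real.norm_eq_abs] at key
    convert key using 2
    ring
  · intro s hs'
    apply HasDerivAt.hasDerivWithinAt
    have e1 : HasDerivAt (fun s : ℝ => s • d) d s := by
      simpa using (hasDerivAt_id s).smul_const d
    have e2 := (hball _ (hs s hs')).2.hasFDerivAt.comp_hasDerivAt s e1
    have e3 := (hasDerivAt_id s).mul_const (fderiv ℝ φ 0 d)
    have e4 := (hasDerivAt_pow 2 s).mul_const ((1/2) * B d d)
    have e5 := (e2.sub e3).sub e4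
    exact e5.congr_deriv (by simp)
  · intro s hs'
    have hs'' : s ∈ Icc (0:ℝ) 1 := ⟨hs'.1, hs'.2.le⟩
    have e1 := (hball _ (hs s hs'')).1
    rw [sub_zero] at e1
    have e2 : fderiv ℝ φ (s • d) d - fderiv ℝ φ 0 d - 2 * s * ((1/2) * B d d)
        = (fderiv ℝ φ (s • d) - fderiv ℝ φ 0 - B (s • d)) d := by
      simp only [sub_apply, map_smul, smul_apply, smul_eq_mul]
      ring
    rw [e2]
    refine (ContinuousLinearMap.le_opNorm _ _).trans ?_
    have e3 : ‖s • d‖ ≤ ‖d‖ := by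
      rw [norm_smul, Real.norm_eq_abs, abs_of_nonneg hs'.1]
      nlinarith [norm_nonneg d, hs'.2]
    have e4 : ε * ‖s • d‖ ≤ ε * ‖d‖ := by gcongr
    have := norm_nonneg d
    nlinarith [e1.trans e4]

lemma aux_taylor_lim {α E : Type*} [NormedAddCommGroup E] [NormedSpace ℝ E] {φ : E → ℝ}
    (h : ContDiffAt ℝ 2 φ 0) {l : Filter α} {t : α → ℝ} {u : α → E} {ξ : E}
    (ht : Tendsto t l (𝓝[>] 0)) (hu : Tendsto u l (𝓝 ξ)) :
    Tendsto (fun n => ((t n) ^ 2)⁻¹ * (φ (t n • u n) - φ 0 - t n * fderiv ℝ φ 0 (u n))) l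
      (𝓝 ((1/2) * fderiv ℝ (fderiv ℝ φ) 0 ξ ξ)) := by
  have ht0 : Tendsto t l (𝓝 0) := tendsto_nhds_of_tendsto_nhdsWithin ht
  have htp : ∀ᶠ n in l, 0 < t n := (tendsto_nhdsWithin_iff.1 ht).2
  have htu : Tendsto (fun n => t n • u n) l (𝓝 0) := by
    simpa using (ht0.smul hu)
  set B := fderiv ℝ (fderiv ℝ φ) 0 with hB
  have h1 : (fun d => φ d - φ 0 - fderiv ℝ φ 0 d - (1/2) * B d d) =o[𝓝 0]
      fun d : E => ‖d‖ ^ 2 := by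
    rw [Asymptotics.isLittleO_iff]
    intro c hc
    filter_upwards [aux_taylor h hc] with d hd
    simpa using hd
  have h2 := h1.comp_tendsto htu
  have h3 : Tendsto (fun n => ((t n) ^ 2)⁻¹ * (φ (t n • u n) - φ 0 - fderiv ℝ φ 0 (t n • u n)
      - (1/2) * B (t n • u n) (t n • u n))) l (𝓝 0) := by
    have h4 := (Asymptotics.isBigO_refl (fun n => ((t n) ^ 2)⁻¹) l).mul_isLittleO h2
    have h5 : (fun n => ((t n) ^ 2)⁻¹ * (φ (t n • u n) - φ 0 - fderiv ℝ φ 0 (t n • u n)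
      - (1/2) * B (t n • u n) (t n • u n))) =o[l] fun n => ‖u n‖ ^ 2 := by
      refine h4.congr' ?_ ?_
      · filter_upwards with n
        simp
      · filter_upwards [htp] with n hn
        simp only [Function.comp, norm_smul, Real.norm_eq_abs, mul_pow, sq_abs]
        field_simp
    exact (Asymptotics.isLittleO_one_iff ℝ).1 (h5.trans_isBigO ((hu.norm.pow 2).isBigO_one ℝ))
  have h6 : Tendsto (fun n => (1/2) * B (u n) (u n)) l (𝓝 ((1/2) * B ξ ξ)) :=
    ((show Continuous fun w => (1/2) * B w w by fun_prop).tendsto ξ).comp hu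
  have h7 := h3.add h6
  rw [zero_add] at h7
  refine h7.congr' ?_
  filter_upwards [htp] with n hn
  simp only [map_smul, smul_apply, smul_eq_mul]
  field_simp
  ring

section proj
variable {E : Type*} [NormedAddCommGroup E] [InnerProductSpace ℝ E] [FiniteDimensional ℝ E]
  {K : Set E}

lemma projK_spec (hne : K.Nonempty) (hcl : IsClosed K) (z : E) :
    projK K z ∈ K ∧ ∀ y ∈ K, ‖z - projK K z‖ ≤ ‖z - y‖ := by
  have : ProperSpace E := FiniteDimensional.proper ℝ E
  have h : ∃ p, p ∈ K ∧ ∀ y ∈ K, ‖z - p‖ ≤ ‖z - y‖ := by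
    obtain ⟨p, hp, hpd⟩ := hcl.exists_infDist_eq_dist hne z
    refine ⟨p, hp, fun y hy => ?_⟩
    rw [← dist_eq_norm, ← dist_eq_norm, ← hpd]
    exact infDist_le_dist_of_mem hy
  rw [projK, dif_pos h]
  exact h.choose_spec

lemma projK_inner (hne : K.Nonempty) (hcl : IsClosed K) (hcv : Convex ℝ K) (z : E) :
    ∀ y ∈ K, ⟪z - projK K z, y - projK K z⟫ ≤ 0 := by
  obtain ⟨h1, h2⟩ := projK_spec hne hcl z
  rw [← norm_eq_iInf_iff_real_inner_le_zero hcv h1]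
  have : Nonempty K := hne.to_subtype
  apply le_antisymm
  · exact le_ciInf fun w => h2 w w.2
  · exact ciInf_le (f := fun w : K => ‖z - w‖) ⟨0, by rintro _ ⟨w, rfl⟩; exact norm_nonneg _⟩
      ⟨_, h1⟩

lemma projK_lip (hne : K.Nonempty) (hcl : IsClosed K) (hcv : Convex ℝ K) (z w : E) :
    ‖projK K z - projK K w‖ ≤ ‖z - w‖ := by
  have h1 := projK_inner hne hcl hcv z _ (projK_spec hne hcl w).1
  have h2 := projK_inner hne hcl hcv w _ (projK_spec hne hcl z).1
  set p := projK K z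
  set q := projK K w
  have h3 : ⟪p - q, p - q⟫ ≤ ⟪z - w, p - q⟫ := by
    have e1 : ⟪z - p, q - p⟫ = - ⟪z - p, p - q⟫ := by rw [← inner_neg_right, neg_sub]
    have e2 : ⟪z - w, p - q⟫ - ⟪p - q, p - q⟫ = ⟪z - p, p - q⟫ - ⟪w - q, p - q⟫ := by
      rw [← inner_sub_left, ← inner_sub_left]; congr 1; abel
    linarith
  rw [real_inner_self_eq_norm_sq] at h3
  have h4 := h3.trans (real_inner_le_norm _ _)
  by_contra hc
  push Not at hc
  nlinarith [norm_nonneg (z - w), norm_nonneg (p - q)]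

lemma projK_eq (hne : K.Nonempty) (hcl : IsClosed K) (hcv : Convex ℝ K) {z l : E}
    (h : l ∈ nCone K z) : projK K (z + l) = z := by
  have h1 := projK_inner hne hcl hcv (z + l) _ h.1
  have h2 := h.2 _ (projK_spec hne hcl (z + l)).1
  set p := projK K (z + l)
  have e : ⟪z + l - p, z - p⟫ + ⟪l, p - z⟫ = ⟪z - p, z - p⟫ := by
    have : ⟪l, p - z⟫ = - ⟪l, z - p⟫ := by rw [← inner_neg_right, neg_sub]
    rw [this, ← sub_eq_add_neg, ← inner_sub_left]; congr 1; abel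
  have h3 : ⟪z - p, z - p⟫ ≤ 0 := by linarith
  rw [real_inner_self_eq_norm_sq] at h3
  have : z - p = 0 := by
    rw [← norm_eq_zero]
    nlinarith [norm_nonneg (z - p)]
  exact (sub_eq_zero.1 this).symm

lemma projK_nCone (hne : K.Nonempty) (hcl : IsClosed K) (hcv : Convex ℝ K) (z : E) :
    z - projK K z ∈ nCone K (projK K z) :=
  ⟨(projK_spec hne hcl z).1, projK_inner hne hcl hcv z⟩

end proj

lemma aux_reduce {E : Type*} [NormedAddCommGroup E] [InnerProductSpace ℝ E]
    [FiniteDimensional ℝ E] {K : Set E} {y : E} (h : C2ConeReducibleAt K y) :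
    ∃ (T : Set E) (Φ ψ : E → E), IsClosed T ∧ (∀ t : ℝ, 0 ≤ t → ∀ z ∈ T, t • z ∈ T) ∧
      HasFDerivAt Φ (ContinuousLinearMap.id ℝ E) y ∧ Φ y = 0 ∧
      ContDiffAt ℝ 2 ψ 0 ∧ HasFDerivAt ψ (ContinuousLinearMap.id ℝ E) 0 ∧ ψ 0 = y ∧
      (∀ᶠ z in 𝓝 y, z ∈ K → Φ z ∈ T ∧ ψ (Φ z) = z) ∧ (∀ᶠ d in 𝓝 (0 : E), d ∈ T → ψ d ∈ K) := by
  obtain ⟨m, U, D, Ξ, hU, hyU, ⟨hDcl, -, hDcone, -⟩, hΞ, hΞy, hsurj, hKU⟩ := h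
  have hΞy2 : ContDiffAt ℝ 2 Ξ y := hΞ.contDiffAt (hU.mem_nhds hyU)
  set A := fderiv ℝ Ξ y with hA
  have hΞd : HasFDerivAt Ξ A y := (hΞy2.differentiableAt (by norm_num)).hasFDerivAt
  obtain ⟨R, hR⟩ := A.exists_rightInverse_of_surjective (LinearMap.range_eq_top.2 hsurj)
  have hR' : ∀ w, A (R w) = w := fun w => by
    have := congrArg (fun L => L w) hR
    simpa using this
  set Φ : E → E := fun z => R (Ξ z) + ((z - y) - R (A (z - y))) with hΦ
  have hΦc : ContDiffAt ℝ 2 Φ y := by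
    have e1 : ContDiffAt ℝ 2 (fun z => R (Ξ z)) y := R.contDiff.contDiffAt.comp y hΞy2
    have e2 : ContDiff ℝ 2 (fun z => (z - y) - R (A (z - y))) := by fun_prop
    exact e1.add e2.contDiffAt
  have hΦd : HasFDerivAt Φ (ContinuousLinearMap.id ℝ E) y := by
    have e1 : HasFDerivAt (fun z => R (Ξ z)) (R ∘SL A) y := R.hasFDerivAt.comp y hΞd
    have e2 : HasFDerivAt (fun z => z - y) (ContinuousLinearMap.id ℝ E) y :=
      (hasFDerivAt_id y).sub_const y
    have e3 : HasFDerivAt (fun z => R (A (z - y))) ((R ∘SL A) ∘SL ContinuousLinearMap.id ℝ E) y :=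
      HasFDerivAt.comp y (g := fun z => R (A z)) (R ∘SL A).hasFDerivAt e2
    have e4 := e1.add (e2.sub e3)
    refine e4.congr_fderiv ?_
    ext v; simp
  have hΦy : Φ y = 0 := by simp [hΦ, hΞy]
  have hAΦ : ∀ z, A (Φ z) = Ξ z := by intro z; simp [hΦ, hR']
  have hΦd' : HasFDerivAt Φ ((ContinuousLinearEquiv.refl ℝ E : E ≃L[ℝ] E) : E →L[ℝ] E) y := hΦd
  have hs := hΦc.hasStrictFDerivAt' hΦd' (by norm_num)
  have hψc := hΦc.to_localInverse hΦd' (by norm_num)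
  have hψd := hs.to_localInverse.hasFDerivAt
  have hri := hs.eventually_right_inverse
  have hli := hs.eventually_left_inverse
  have hψy := hs.localInverse_apply_image
  rw [hΦy] at hψc hψd hri hψy
  set ψ : E → E := HasStrictFDerivAt.localInverse Φ _ y hs with hψ
  refine ⟨A ⁻¹' D, Φ, ψ, hDcl.preimage A.continuous, ?_, hΦd, hΦy, hψc, hψd, hψy, ?_, ?_⟩
  · intro t ht z hz
    simp only [mem_preimage, map_smul]
    exact hDcone t ht _ hz
  · filter_upwards [hli, hU.mem_nhds hyU] with z hz hzU hzK
    refine ⟨?_, hz⟩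
    have : z ∈ K ∩ U := ⟨hzK, hzU⟩
    rw [hKU] at this
    rw [mem_preimage, hAΦ]; exact this.2
  · have hcont : Tendsto ψ (𝓝 0) (𝓝 y) := by
      have := hψd.continuousAt.tendsto
      rwa [hψy] at this
    filter_upwards [hri, hcont (hU.mem_nhds hyU)] with d hd hdU hdT
    have hmem : ψ d ∈ {y' ∈ U | Ξ y' ∈ D} := by
      refine ⟨hdU, ?_⟩
      rw [← hAΦ, hd]; exact hdT
    rw [← hKU] at hmem
    exact hmem.1

lemma proj_unique {E : Type*} [NormedAddCommGroup E] [InnerProductSpace ℝ E]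
    [FiniteDimensional ℝ E] {K : Set E} (hne : K.Nonempty) (hcl : IsClosed K) (hcv : Convex ℝ K)
    {y lam : E} (hred : C2ConeReducibleAt K y) (hlam : lam ∈ nCone K y) (h : E)
    {l1 l2 : Filter ℝ} [l1.NeBot] [l2.NeBot] (hl1 : l1 ≤ 𝓝[>] 0) (hl2 : l2 ≤ 𝓝[>] 0) {w1 w2 : E}
    (hw1 : Tendsto (fun t : ℝ => t⁻¹ • (projK K (y + lam + t • h) - y)) l1 (𝓝 w1))
    (hw2 : Tendsto (fun t : ℝ => t⁻¹ • (projK K (y + lam + t • h) - y)) l2 (𝓝 w2)) :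
    w1 = w2 := by
  obtain ⟨T, Φ, ψ, hTcl, hTcone, hΦd, hΦy, hψc, hψd, hψ0, hKT, hTK⟩ := aux_reduce hred
  set P : ℝ → E := fun t => projK K (y + lam + t • h) with hP
  set G : ℝ → E → ℝ := fun t z => - ⟪lam, z - y⟫ - t * ⟪h, z - y⟫ + (1/2) * ‖z - y‖ ^ 2 with hG
  have hPK : ∀ t, P t ∈ K := fun t => (projK_spec hne hcl _).1
  have hmin : ∀ t, ∀ z ∈ K, G t (P t) ≤ G t z := by
    intro t z hz
    have h1 := (projK_spec hne hcl (y + lam + t • h)).2 z hz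
    have e : ∀ z, ‖y + lam + t • h - z‖ ^ 2 = ‖lam + t • h‖ ^ 2 + 2 * G t z := by
      intro z
      have : y + lam + t • h - z = (lam + t • h) - (z - y) := by abel
      rw [this, norm_sub_sq_real, inner_add_left, real_inner_smul_left]
      simp only [hG]; ring
    have h2 : ‖y + lam + t • h - P t‖ ^ 2 ≤ ‖y + lam + t • h - z‖ ^ 2 := by
      gcongr
    rw [e, e] at h2
    linarith
  -- scaled tangent curves
  have hcurve : ∀ {l : Filter ℝ}, l ≤ 𝓝[>] 0 → ∀ {u : ℝ → E} {ξ : E}, Tendsto u l (𝓝 ξ) →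
      Tendsto (fun t : ℝ => t⁻¹ • (ψ (t • u t) - y)) l (𝓝 ξ) := by
    intro l hl u ξ hu
    have := aux_lim hψd (t := fun t : ℝ => t) (l := l) (tendsto_id'.2 hl) hu
    simpa [hψ0] using this
  set φ : E → ℝ := fun d => ⟪lam, ψ d - y⟫ with hφ
  have hφc : ContDiffAt ℝ 2 φ 0 := by
    have : ContDiffAt ℝ 2 (fun d => ψ d - y) 0 := hψc.sub contDiffAt_const
    exact contDiffAt_const.inner ℝ this
  have hφ0 : φ 0 = 0 := by simp [hφ, hψ0]
  have hφd : ∀ u, fderiv ℝ φ 0 u = ⟪lam, u⟫ := by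
    intro u
    have e1 : HasFDerivAt (fun d => ψ d - y) (ContinuousLinearMap.id ℝ E) 0 := hψd.sub_const y
    have e2 : HasFDerivAt φ ((innerSL ℝ lam) ∘SL ContinuousLinearMap.id ℝ E) 0 :=
      HasFDerivAt.comp (0 : E) (g := fun z => innerSL ℝ lam z) (innerSL ℝ lam).hasFDerivAt e1
    rw [e2.fderiv]; simp
  set Q : E → ℝ := fun w => - ((1/2) * fderiv ℝ (fderiv ℝ φ) 0 w w) - ⟪h, w⟫ + (1/2) * ‖w‖ ^ 2
    with hQ
  have hpos : ∀ {l : Filter ℝ}, l ≤ 𝓝[>] 0 → ∀ᶠ t in l, 0 < t := fun hl =>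
    hl self_mem_nhdsWithin
  have hGlim : ∀ {l : Filter ℝ}, l ≤ 𝓝[>] 0 → ∀ {u : ℝ → E} {ξ : E}, Tendsto u l (𝓝 ξ) →
      Tendsto (fun t : ℝ => (t ^ 2)⁻¹ * (G t (ψ (t • u t)) + t * ⟪lam, u t⟫)) l (𝓝 (Q ξ)) := by
    intro l hl u ξ hu
    have a1 := aux_taylor_lim hφc (t := fun t : ℝ => t) (l := l) (tendsto_id'.2 hl) hu
    have a2 := hcurve hl hu
    have a3 : Tendsto (fun t : ℝ => ⟪h, t⁻¹ • (ψ (t • u t) - y)⟫) l (𝓝 ⟪h, ξ⟫) :=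
      tendsto_const_nhds.inner a2
    have a4 := ((a2.norm.pow 2).const_mul (1/2 : ℝ))
    refine ((a1.neg.sub a3).add a4).congr' ?_
    filter_upwards [hpos hl] with t ht
    rw [hφd, hφ0, real_inner_smul_right, norm_smul, Real.norm_eq_abs, mul_pow, sq_abs]
    simp only [hG, hφ]
    field_simp
    ring
  have hlamT : ∀ d ∈ T, ⟪lam, d⟫ ≤ 0 := by
    intro d hd
    have a1 := hcurve (le_refl (𝓝[>] (0:ℝ))) (u := fun _ => d) tendsto_const_nhds
    have a2 : Tendsto (fun t : ℝ => ⟪lam, t⁻¹ • (ψ (t • d) - y)⟫) (𝓝[>] 0) (𝓝 ⟪lam, d⟫) :=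
      tendsto_const_nhds.inner a1
    have a3 : Tendsto (fun t : ℝ => t • d) (𝓝[>] 0) (𝓝 0) := by
      have : Tendsto (fun t : ℝ => t • d) (𝓝 0) (𝓝 ((0:ℝ) • d)) :=
        (Continuous.tendsto (by fun_prop) _)
      rw [zero_smul] at this
      exact this.mono_left nhdsWithin_le_nhds
    refine le_of_tendsto a2 ?_
    filter_upwards [a3.eventually hTK, self_mem_nhdsWithin] with t ht htp
    have htp : 0 < t := htp
    rw [real_inner_smul_right]
    exact mul_nonpos_of_nonneg_of_nonpos (by positivity)
      (hlam.2 _ (ht (hTcone t htp.le d hd)))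
  have hcluster : ∀ {l : Filter ℝ} [l.NeBot], l ≤ 𝓝[>] 0 → ∀ {w : E},
      Tendsto (fun t : ℝ => t⁻¹ • (P t - y)) l (𝓝 w) →
      w ∈ T ∧ ⟪lam, w⟫ = 0 ∧ ∀ (z : ℝ → E) (c : ℝ), (∀ᶠ t in l, z t ∈ K) →
        Tendsto (fun t : ℝ => (t ^ 2)⁻¹ * G t (z t)) l (𝓝 c) → Q w ≤ c := by
    intro l hne hl w hw
    have hid : Tendsto (fun t : ℝ => t) l (𝓝[>] 0) := tendsto_id'.2 hl
    have hid0 : Tendsto (fun t : ℝ => t) l (𝓝 0) := tendsto_nhds_of_tendsto_nhdsWithin hid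
    have hPy : Tendsto P l (𝓝 y) := by
      have := tendsto_const_nhds (x := y).add (hid0.smul hw)
      rw [zero_smul, add_zero] at this
      refine this.congr' ?_
      filter_upwards [hpos hl] with t ht
      rw [smul_smul, mul_inv_cancel₀ ht.ne', one_smul, add_sub_cancel]
    have hu : Tendsto (fun t : ℝ => t⁻¹ • Φ (P t)) l (𝓝 w) := by
      have := aux_lim hΦd hid hw
      rw [ContinuousLinearMap.id_apply] at this
      refine this.congr' ?_
      filter_upwards [hpos hl] with t ht
      rw [smul_smul t, mul_inv_cancel₀ ht.ne', one_smul, add_sub_cancel, hΦy, sub_zero]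
    have hev := hPy.eventually hKT
    have huT : ∀ᶠ t in l, t⁻¹ • Φ (P t) ∈ T := by
      filter_upwards [hev, hpos hl] with t ht htp
      exact hTcone _ (by positivity) _ (ht (hPK t)).1
    refine ⟨hTcl.mem_of_tendsto hu huT, ?_, ?_⟩
    · have b1 : Tendsto (fun t : ℝ => ⟪lam, t⁻¹ • (P t - y)⟫) l (𝓝 ⟪lam, w⟫) :=
        tendsto_const_nhds.inner hw
      apply le_antisymm
      · refine le_of_tendsto b1 ?_
        filter_upwards [hpos hl] with t ht
        rw [real_inner_smul_right]
        exact mul_nonpos_of_nonneg_of_nonpos (by positivity) (hlam.2 _ (hPK t))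
      · have b2 : Tendsto (fun t : ℝ => - (t * ⟪h, t⁻¹ • (P t - y)⟫)) l (𝓝 (-(0 * ⟪h, w⟫))) :=
          (hid0.mul (tendsto_const_nhds.inner hw)).neg
        rw [zero_mul, neg_zero] at b2
        refine le_of_tendsto_of_tendsto b2 b1 ?_
        filter_upwards [hpos hl] with t ht
        have b3 := hmin t y hlam.1
        simp only [hG, sub_self, inner_zero_right, norm_zero] at b3
        rw [real_inner_smul_right, real_inner_smul_right]
        have b4 : - (t * ⟪h, P t - y⟫) ≤ ⟪lam, P t - y⟫ := by
          nlinarith [sq_nonneg ‖P t - y‖]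
        have b5 : - (t * (t⁻¹ * ⟪h, P t - y⟫)) = t⁻¹ * (- (t * ⟪h, P t - y⟫)) := by ring
        rw [b5]
        exact mul_le_mul_of_nonneg_left b4 (by positivity)
    · intro z c hz hc
      refine le_of_tendsto_of_tendsto (hGlim hl hu) hc ?_
      filter_upwards [hpos hl, huT, hev, hz] with t ht htT htψ hzK
      have c1 : ψ (t • (t⁻¹ • Φ (P t))) = P t := by
        rw [smul_smul, mul_inv_cancel₀ ht.ne', one_smul, (htψ (hPK t)).2]
      rw [c1]
      refine mul_le_mul_of_nonneg_left ?_ (by positivity)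
      have c2 := hmin t _ hzK
      have c3 := mul_nonpos_of_nonneg_of_nonpos ht.le (hlamT _ htT)
      linarith
  obtain ⟨hT1, hz1, hm1⟩ := hcluster hl1 hw1
  obtain ⟨hT2, hz2, hm2⟩ := hcluster hl2 hw2
  have hcK : ∀ {l : Filter ℝ}, l ≤ 𝓝[>] 0 → ∀ w ∈ T, ∀ᶠ t in l, ψ (t • w) ∈ K := by
    intro l hl w hw
    have a3 : Tendsto (fun t : ℝ => t • w) l (𝓝 0) := by
      have : Tendsto (fun t : ℝ => t • w) (𝓝 0) (𝓝 ((0:ℝ) • w)) :=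
        (Continuous.tendsto (by fun_prop) _)
      rw [zero_smul] at this
      exact this.mono_left (hl.trans nhdsWithin_le_nhds)
    filter_upwards [a3.eventually hTK, hpos hl] with t ht htp
    exact ht (hTcone t htp.le w hw)
  have hcG : ∀ {l : Filter ℝ}, l ≤ 𝓝[>] 0 → ∀ w, ⟪lam, w⟫ = 0 →
      Tendsto (fun t : ℝ => (t ^ 2)⁻¹ * G t (ψ (t • w))) l (𝓝 (Q w)) := by
    intro l hl w hw
    have := hGlim hl (u := fun _ => w) tendsto_const_nhds
    simpa [hw] using this
  have hQ12 : Q w1 ≤ Q w2 := hm1 _ _ (hcK hl1 w2 hT2) (hcG hl1 w2 hz2)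
  have hQ21 : Q w2 ≤ Q w1 := hm2 _ _ (hcK hl2 w1 hT1) (hcG hl2 w1 hz1)
  have hmid := hm1 (fun t => (1/2 : ℝ) • ψ (t • w1) + (1/2 : ℝ) • ψ (t • w2))
    ((1/2) * Q w1 + (1/2) * Q w2 - (1/8) * ‖w1 - w2‖ ^ 2) ?_ ?_
  · have : ‖w1 - w2‖ = 0 := by nlinarith [norm_nonneg (w1 - w2)]
    exact sub_eq_zero.1 (norm_eq_zero.1 this)
  · filter_upwards [hcK hl1 w1 hT1, hcK hl1 w2 hT2] with t h1 h2
    exact hcv h1 h2 (by norm_num) (by norm_num) (by norm_num)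
  · have d1 := hcG hl1 w1 hz1
    have d2 := hcG hl1 w2 hz2
    have d3 := (hcurve hl1 (u := fun _ => w1) tendsto_const_nhds).sub
      (hcurve hl1 (u := fun _ => w2) tendsto_const_nhds)
    refine (((d1.const_mul (1/2)).add (d2.const_mul (1/2))).sub
      ((d3.norm.pow 2).const_mul (1/8))).congr' ?_
    filter_upwards [hpos hl1] with t ht
    rw [← smul_sub, norm_smul, Real.norm_eq_abs, mul_pow, sq_abs]
    set p := ψ (t • w1) with hp
    set q := ψ (t • w2) with hq
    have e1 : p - y - (q - y) = p - q := by abel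
    have e2 : (1/2 : ℝ) • p + (1/2 : ℝ) • q - y = (1/2 : ℝ) • ((p - y) + (q - y)) := by
      module
    simp only [hG]
    rw [e2, norm_smul, mul_pow, norm_sub_sq_real (p - y) (q - y), norm_add_sq_real, real_inner_smul_right,
      real_inner_smul_right, inner_add_right, inner_add_right, Real.norm_eq_abs,
      abs_of_pos (by norm_num : (0:ℝ) < 1/2)]
    field_simp
    ring

lemma proj_dirDeriv {E : Type*} [NormedAddCommGroup E] [InnerProductSpace ℝ E]
    [FiniteDimensional ℝ E] {K : Set E} (hne : K.Nonempty) (hcl : IsClosed K) (hcv : Convex ℝ K)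
    {y lam : E} (hred : C2ConeReducibleAt K y) (hlam : lam ∈ nCone K y) (h : E)
    {l1 : Filter ℝ} [l1.NeBot] (hl1 : l1 ≤ 𝓝[>] 0) {w1 : E}
    (hw1 : Tendsto (fun t : ℝ => t⁻¹ • (projK K (y + lam + t • h) - y)) l1 (𝓝 w1)) :
    HasDirDeriv (projK K) (y + lam) h w1 := by
  have : ProperSpace E := FiniteDimensional.proper ℝ E
  have hy : projK K (y + lam) = y := projK_eq hne hcl hcv hlam
  unfold HasDirDeriv
  rw [hy]
  refine tendsto_iff_ultrafilter _ _ _ |>.2 ?_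
  intro U hU
  have hb : ∀ᶠ t : ℝ in U, t⁻¹ • (projK K (y + lam + t • h) - y) ∈ closedBall (0 : E) ‖h‖ := by
    have : ∀ᶠ t : ℝ in U, 0 < t := hU self_mem_nhdsWithin
    filter_upwards [this] with t ht
    rw [mem_closedBall_zero_iff, norm_smul, Real.norm_eq_abs, abs_of_pos (inv_pos.2 ht)]
    have h1 := projK_lip hne hcl hcv (y + lam + t • h) (y + lam)
    rw [hy, add_sub_cancel_left, norm_smul, Real.norm_eq_abs, abs_of_pos ht] at h1
    rw [inv_mul_le_iff₀ ht]
    exact h1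
  obtain ⟨w, -, hw⟩ := (isCompact_closedBall (0 : E) ‖h‖).ultrafilter_le_nhds'
    (U.map fun t : ℝ => t⁻¹ • (projK K (y + lam + t • h) - y)) hb
  have hw' : Tendsto (fun t : ℝ => t⁻¹ • (projK K (y + lam + t • h) - y)) U (𝓝 w) := hw
  have := proj_unique hne hcl hcv hred hlam h hl1 hU hw1 hw'
  rw [this]; exact hw'

lemma clm_tendsto {α E F : Type*} [NormedAddCommGroup E] [NormedSpace ℝ E]
    [NormedAddCommGroup F] [NormedSpace ℝ F] {l : Filter α} {A : α → E →L[ℝ] F} {u : α → E}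
    {A0 : E →L[ℝ] F} {u0 : E} (hA : Tendsto A l (𝓝 A0)) (hu : Tendsto u l (𝓝 u0)) :
    Tendsto (fun n => A n (u n)) l (𝓝 (A0 u0)) :=
  (isBoundedBilinearMap_apply.continuous.tendsto (A0, u0)).comp (hA.prodMk_nhds hu)

lemma grad_L {X Y : Type*} [NormedAddCommGroup X] [InnerProductSpace ℝ X]
    [FiniteDimensional ℝ X] [NormedAddCommGroup Y] [InnerProductSpace ℝ Y]
    [FiniteDimensional ℝ Y] {f : X → ℝ} {g : X → Y} (hf : ContDiff ℝ 2 f) (hg : ContDiff ℝ 2 g)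
    (l : Y) (u : X) : gradient (fun v => f v + ⟪l, g v⟫) u
      = gradient f u + ContinuousLinearMap.adjoint (fderiv ℝ g u) l := by
  have h1 : HasFDerivAt f (fderiv ℝ f u) u := (hf.differentiable (by norm_num) u).hasFDerivAt
  have h2 : HasFDerivAt g (fderiv ℝ g u) u := (hg.differentiable (by norm_num) u).hasFDerivAt
  have h3 : HasFDerivAt (fun v => ⟪l, g v⟫) ((innerSL ℝ l) ∘SL fderiv ℝ g u) u :=
    HasFDerivAt.comp u (g := fun z => innerSL ℝ l z) (innerSL ℝ l).hasFDerivAt h2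
  refine ext_inner_right ℝ fun w => ?_
  rw [inner_add_left, ContinuousLinearMap.adjoint_inner_left]
  simp only [gradient, InnerProductSpace.toDual_symm_apply]
  have h4 : HasFDerivAt (fun v => f v + ⟪l, g v⟫) (fderiv ℝ f u + (innerSL ℝ l) ∘SL fderiv ℝ g u) u :=
    h1.add h3
  rw [h4.fderiv]
  simp

lemma hess_L {X Y : Type*} [NormedAddCommGroup X] [InnerProductSpace ℝ X]
    [FiniteDimensional ℝ X] [NormedAddCommGroup Y] [InnerProductSpace ℝ Y]
    [FiniteDimensional ℝ Y] {f : X → ℝ} {g : X → Y} (hf : ContDiff ℝ 2 f) (hg : ContDiff ℝ 2 g)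
    (l : Y) (x : X) : HasFDerivAt (fun u => gradient f u
      + ContinuousLinearMap.adjoint (fderiv ℝ g u) l) (hessLxx f g x l) x := by
  have h0 : (fun u => gradient f u + ContinuousLinearMap.adjoint (fderiv ℝ g u) l)
      = fun u => gradient (fun v => f v + ⟪l, g v⟫) u := by
    ext1 u; rw [grad_L hf hg]
  rw [h0]
  apply DifferentiableAt.hasFDerivAt
  have h1 : ContDiff ℝ 2 (fun v => f v + ⟪l, g v⟫) := hf.add (contDiff_const.inner ℝ hg)
  have h2 : DifferentiableAt ℝ (fderiv ℝ (fun v => f v + ⟪l, g v⟫)) x :=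
    (h1.fderiv_right (m := 1) (by norm_num)).differentiable (by norm_num) x
  let L : (StrongDual ℝ X) →L[ℝ] X :=
    AddMonoidHom.toRealLinearMap ((InnerProductSpace.toDual ℝ X).symm : StrongDual ℝ X →+ X)
      (InnerProductSpace.toDual ℝ X).symm.continuous
  exact L.differentiableAt.comp x h2

lemma stmt_fwd {X Y : Type*} [NormedAddCommGroup X] [InnerProductSpace ℝ X]
    [FiniteDimensional ℝ X] [NormedAddCommGroup Y] [InnerProductSpace ℝ Y]
    [FiniteDimensional ℝ Y] (f : X → ℝ) (g : X → Y) (K : Set Y)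
    (hf : ContDiff ℝ 2 f) (hg : ContDiff ℝ 2 g)
    (hKne : K.Nonempty) (hKcl : IsClosed K) (hKcv : Convex ℝ K)
    (x0 : X) (l0 : Y) (hKKT : (x0, l0) ∈ sKKT f g K 0 0)
    (hS : IsolatedCalm (fun q : X × Y => sKKT f g K q.1 q.2) ((0 : X), (0 : Y)) (x0, l0)) :
    Noncritical f g K x0 l0 := by
  intro ξ v h1 h2
  obtain ⟨κ, ε, δ, hκ, hε, hδ, hS⟩ := hS
  have hG0 : gradient f x0 + ContinuousLinearMap.adjoint (fderiv ℝ g x0) l0 = 0 := hKKT.1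
  have hlam : l0 ∈ nCone K (g x0) := by simpa using hKKT.2
  have hgd : HasFDerivAt g (fderiv ℝ g x0) x0 := (hg.differentiable (by norm_num) x0).hasFDerivAt
  have hHd := hess_L hf hg l0 x0
  have hy : projK K (g x0 + l0) = g x0 := projK_eq hKne hKcl hKcv hlam
  unfold HasDirDeriv at h2
  rw [hy] at h2
  set h := fderiv ℝ g x0 ξ + v with hh
  set P : ℝ → Y := fun t => projK K (g x0 + l0 + t • h) with hP
  set x : ℝ → X := fun t => x0 + t • ξ with hx
  set lm : ℝ → Y := fun t => g x0 + l0 + t • h - P t with hlm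
  set b : ℝ → Y := fun t => g (x t) - P t with hb
  set a : ℝ → X := fun t => gradient f (x t) + ContinuousLinearMap.adjoint (fderiv ℝ g (x t)) (lm t)
    with ha
  have hid : Tendsto (fun t : ℝ => t) (𝓝[>] 0) (𝓝[>] 0) := tendsto_id
  have hid0 : Tendsto (fun t : ℝ => t) (𝓝[>] 0) (𝓝 0) := nhdsWithin_le_nhds
  have hpos : ∀ᶠ t : ℝ in 𝓝[>] 0, 0 < t := self_mem_nhdsWithin
  have hx0 : Tendsto x (𝓝[>] 0) (𝓝 x0) := by
    have : Tendsto x (𝓝[>] 0) (𝓝 (x0 + (0:ℝ) • ξ)) :=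
      tendsto_const_nhds.add (hid0.smul tendsto_const_nhds)
    simpa using this
  have hlmq : Tendsto (fun t : ℝ => t⁻¹ • (lm t - l0)) (𝓝[>] 0) (𝓝 v) := by
    have := (tendsto_const_nhds (x := h)).sub h2
    have e : h - fderiv ℝ g x0 ξ = v := by simp [hh]
    rw [e] at this
    refine this.congr' ?_
    filter_upwards [hpos] with t ht
    have e2 : lm t - l0 = t • h - (P t - g x0) := by simp only [hlm]; abel
    rw [e2, smul_sub t⁻¹ (t • h), smul_smul, inv_mul_cancel₀ ht.ne', one_smul]
  have hgq : Tendsto (fun t : ℝ => t⁻¹ • (g (x t) - g x0)) (𝓝[>] 0) (𝓝 (fderiv ℝ g x0 ξ)) :=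
    aux_lim hgd hid (tendsto_const_nhds (x := ξ))
  have hbq : Tendsto (fun t : ℝ => t⁻¹ • b t) (𝓝[>] 0) (𝓝 0) := by
    have := hgq.sub h2
    rw [sub_self] at this
    refine this.congr' ?_
    filter_upwards with t
    rw [← smul_sub]; congr 1; simp only [hb, hP]; abel
  have hDg : Continuous fun u => ContinuousLinearMap.adjoint (fderiv ℝ g u) :=
    ContinuousLinearMap.adjoint.continuous.comp (hg.continuous_fderiv (by norm_num))
  have haq : Tendsto (fun t : ℝ => t⁻¹ • a t) (𝓝[>] 0) (𝓝 0) := by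
    have e1 := aux_lim hHd hid (tendsto_const_nhds (x := ξ))
    have e2 : Tendsto (fun t : ℝ => ContinuousLinearMap.adjoint (fderiv ℝ g (x t))
        (t⁻¹ • (lm t - l0))) (𝓝[>] 0) (𝓝 (ContinuousLinearMap.adjoint (fderiv ℝ g x0) v)) :=
      clm_tendsto ((hDg.tendsto x0).comp hx0) hlmq
    have e3 := e1.add e2
    rw [h1] at e3
    refine e3.congr' ?_
    filter_upwards with t
    rw [hG0, sub_zero, map_smul, ← smul_add, map_sub]
    congr 1
    simp only [ha]; abel
  have toz : ∀ {Z : Type _} [NormedAddCommGroup Z] [NormedSpace ℝ Z] {c : ℝ → Z} {w : Z},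
      Tendsto (fun t : ℝ => t⁻¹ • c t) (𝓝[>] 0) (𝓝 w) → Tendsto c (𝓝[>] 0) (𝓝 0) := by
    intro Z _ _ c w hc
    have := hid0.smul hc
    rw [zero_smul] at this
    refine this.congr' ?_
    filter_upwards [hpos] with t ht
    rw [smul_smul, mul_inv_cancel₀ ht.ne', one_smul]
  have ha0 := toz haq
  have hb0 : Tendsto b (𝓝[>] 0) (𝓝 0) := by
    have := hid0.smul hbq
    rw [zero_smul] at this
    refine this.congr' ?_
    filter_upwards [hpos] with t ht
    rw [smul_smul, mul_inv_cancel₀ ht.ne', one_smul]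
  have hl0 : Tendsto (fun t => lm t - l0) (𝓝[>] 0) (𝓝 0) := by
    have := hid0.smul hlmq
    rw [zero_smul] at this
    refine this.congr' ?_
    filter_upwards [hpos] with t ht
    rw [smul_smul, mul_inv_cancel₀ ht.ne', one_smul]
  have hx00 : Tendsto (fun t => x t - x0) (𝓝[>] 0) (𝓝 0) := by
    simpa using hx0.sub_const x0
  have hab : Tendsto (fun t => ‖((a t, b t) : X × Y)‖) (𝓝[>] 0) (𝓝 0) := by
    have := (ha0.prodMk_nhds hb0).norm
    simpa using this
  have hxl : Tendsto (fun t => ‖((x t - x0, lm t - l0) : X × Y)‖) (𝓝[>] 0) (𝓝 0) := by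
    have := (hx00.prodMk_nhds hl0).norm
    simpa using this
  have hfin : Tendsto (fun t => κ * ‖((t⁻¹ • a t, t⁻¹ • b t) : X × Y)‖) (𝓝[>] 0) (𝓝 0) := by
    have := (haq.prodMk_nhds hbq).norm.const_mul κ
    simpa using this
  have hle : ‖ξ‖ ≤ 0 := by
    refine ge_of_tendsto hfin ?_
    filter_upwards [hpos, hab.eventually (Iic_mem_nhds hε), hxl.eventually (Iic_mem_nhds hδ)]
      with t ht h3 h4
    have hmem : (x t, lm t) ∈ sKKT f g K (a t) (b t) := by
      refine ⟨rfl, ?_⟩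
      have : g (x t) - b t = P t := by simp [hb]
      change lm t ∈ nCone K (g (x t) - b t)
      rw [this]
      exact projK_nCone hKne hKcl hKcv _
    have h5 := hS (a t, b t) (by simpa using h3) (x t, lm t) hmem (by simpa using h4)
    have h6 : t * ‖ξ‖ ≤ ‖((x t, lm t) : X × Y) - (x0, l0)‖ := by
      refine le_trans ?_ (norm_fst_le _)
      simp [hx, norm_smul, abs_of_pos ht]
    have h7 : ((t⁻¹ • a t, t⁻¹ • b t) : X × Y) = t⁻¹ • (a t, b t) := rfl
    have h8 : ((a t, b t) : X × Y) - (0, 0) = (a t, b t) := by simp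
    rw [h8] at h5
    rw [h7, norm_smul, Real.norm_eq_abs, abs_of_pos (inv_pos.2 ht)]
    have h9 := h6.trans h5
    calc ‖ξ‖ = t⁻¹ * (t * ‖ξ‖) := by field_simp
      _ ≤ t⁻¹ * (κ * ‖((a t, b t) : X × Y)‖) := by gcongr
      _ = _ := by ring
  exact norm_le_zero_iff.1 hle

lemma stmt_bwd {X Y : Type*} [NormedAddCommGroup X] [InnerProductSpace ℝ X]
    [FiniteDimensional ℝ X] [NormedAddCommGroup Y] [InnerProductSpace ℝ Y]
    [FiniteDimensional ℝ Y] (f : X → ℝ) (g : X → Y) (K : Set Y)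
    (hf : ContDiff ℝ 2 f) (hg : ContDiff ℝ 2 g)
    (hKne : K.Nonempty) (hKcl : IsClosed K) (hKcv : Convex ℝ K)
    (hKred : C2ConeReducible K)
    (x0 : X) (l0 : Y) (hKKT : (x0, l0) ∈ sKKT f g K 0 0)
    (hM : IsolatedCalm (fun q : X × X × Y => mSet f g K q.1 q.2.1 q.2.2) (x0, 0, 0) l0)
    (hN : Noncritical f g K x0 l0) :
    IsolatedCalm (fun q : X × Y => sKKT f g K q.1 q.2) ((0 : X), (0 : Y)) (x0, l0) := by
  by_contra hS
  have : ProperSpace X := FiniteDimensional.proper ℝ X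
  have : ProperSpace Y := FiniteDimensional.proper ℝ Y
  have hG0 : gradient f x0 + ContinuousLinearMap.adjoint (fderiv ℝ g x0) l0 = 0 := hKKT.1
  have hlam : l0 ∈ nCone K (g x0) := by simpa using hKKT.2
  have hgd : HasFDerivAt g (fderiv ℝ g x0) x0 := (hg.differentiable (by norm_num) x0).hasFDerivAt
  have hHd := hess_L hf hg l0 x0
  have hy : projK K (g x0 + l0) = g x0 := projK_eq hKne hKcl hKcv hlam
  have hseq : ∀ n : ℕ, ∃ (a : X) (b : Y) (x : X) (lm : Y), (x, lm) ∈ sKKT f g K a b ∧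
      max ‖a‖ ‖b‖ ≤ 1 / ((n : ℝ) + 1) ∧ max ‖x - x0‖ ‖lm - l0‖ ≤ 1 / ((n : ℝ) + 1) ∧
      ((n : ℝ) + 1) * max ‖a‖ ‖b‖ < max ‖x - x0‖ ‖lm - l0‖ := by
    intro n
    by_contra hcon
    apply hS
    refine ⟨(n : ℝ) + 1, 1 / ((n : ℝ) + 1), 1 / ((n : ℝ) + 1), by positivity, by positivity,
      by positivity, ?_⟩
    rintro ⟨a, b⟩ hab ⟨x, lm⟩ hmem hxl
    by_contra hlt
    apply hcon
    rw [not_le] at hlt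
    refine ⟨a, b, x, lm, hmem, ?_, ?_, ?_⟩
    · simpa [Prod.norm_def] using hab
    · simpa [Prod.norm_def] using hxl
    · simpa [Prod.norm_def] using hlt
  choose a b x lm hmem hab hxl hlt using hseq
  obtain ⟨κ₀, ε, δ, hκ₀, hε, hδ, hM⟩ := hM
  set κ := max κ₀ 1 with hκ
  have hκ1 : 1 ≤ κ := le_max_right _ _
  set t : ℕ → ℝ := fun n => ‖x n - x0‖ with ht
  have hlim : Tendsto (fun n : ℕ => 1 / ((n : ℝ) + 1)) atTop (𝓝 0) :=
    tendsto_one_div_add_atTop_nhds_zero_nat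
  have hnat : Tendsto (fun n : ℕ => (n : ℝ) + 1) atTop atTop :=
    tendsto_atTop_add_const_right _ _ tendsto_natCast_atTop_atTop
  have hmain : ∀ᶠ n in atTop, 0 < t n ∧ max ‖x n - x0‖ ‖lm n - l0‖ ≤ κ * t n := by
    filter_upwards [hlim.eventually (Iic_mem_nhds hε), hlim.eventually (Iic_mem_nhds hδ),
      hnat.eventually_ge_atTop κ] with n h1 h2 h3
    have h1 : 1 / ((n : ℝ) + 1) ≤ ε := h1
    have h2 : 1 / ((n : ℝ) + 1) ≤ δ := h2
    have e1 : ‖((x n, a n, b n) : X × X × Y) - (x0, 0, 0)‖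
        = max (t n) (max ‖a n‖ ‖b n‖) := by
      simp [Prod.norm_def, ht]
    have h4 := hM (x n, a n, b n) (by
      rw [e1]
      exact max_le ((le_max_left _ _).trans ((hxl n).trans h1)) ((hab n).trans h1))
      (lm n) (hmem n) ((le_max_right _ _).trans ((hxl n).trans h2))
    rw [e1] at h4
    set ρ := max ‖a n‖ ‖b n‖ with hρ
    set p := max ‖x n - x0‖ ‖lm n - l0‖ with hp
    have hρ0 : 0 ≤ ρ := (norm_nonneg _).trans (le_max_left _ _)
    have ht0 : 0 ≤ t n := norm_nonneg _
    have h5 : κ * ρ < p := lt_of_le_of_lt (mul_le_mul_of_nonneg_right h3 hρ0) (hlt n)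
    have h6 : ‖lm n - l0‖ ≤ κ * max (t n) ρ :=
      h4.trans (mul_le_mul_of_nonneg_right (le_max_left _ _) (ht0.trans (le_max_left _ _)))
    have h7 : t n ≤ κ * t n := by nlinarith
    have h8 : p ≤ κ * t n := by
      by_contra h9
      rw [not_le] at h9
      have h10 : κ * max (t n) ρ < p := by
        rcases max_choice (t n) ρ with h | h <;> rw [h] <;> assumption
      have : p < p := by
        conv_lhs => rw [hp]
        exact max_lt (lt_of_le_of_lt h7 h9) (h6.trans_lt h10)
      exact lt_irrefl _ this
    refine ⟨?_, h8⟩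
    have h11 : 0 < p := lt_of_le_of_lt (by positivity) h5
    by_contra h12
    have : t n = 0 := le_antisymm (not_lt.1 h12) ht0
    rw [this] at h8
    linarith
  set U : Ultrafilter ℕ := hyperfilter ℕ with hU
  have hUle : (U : Filter ℕ) ≤ atTop := Nat.hyperfilter_le_atTop
  have hmU := hUle hmain
  have hmU : ∀ᶠ n in (U : Filter ℕ), 0 < t n ∧ max ‖x n - x0‖ ‖lm n - l0‖ ≤ κ * t n := hmU
  have hposU : ∀ᶠ n in (U : Filter ℕ), 0 < t n := hmU.mono fun n h => h.1
  have htl : Tendsto t U (𝓝[>] 0) := by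
    refine tendsto_nhdsWithin_iff.2 ⟨?_, hposU⟩
    refine Tendsto.mono_left ?_ hUle
    exact squeeze_zero (fun n => norm_nonneg _) (fun n => (le_max_left _ _).trans (hxl n)) hlim
  obtain ⟨ξ, hξs, hξ⟩ := (isCompact_sphere (0 : X) 1).ultrafilter_le_nhds'
    (U.map fun n => (t n)⁻¹ • (x n - x0)) (by
      change ∀ᶠ n in (U : Filter ℕ), (t n)⁻¹ • (x n - x0) ∈ sphere (0 : X) 1
      filter_upwards [hposU] with n hn
      rw [mem_sphere_zero_iff_norm, norm_smul, Real.norm_eq_abs, abs_of_pos (inv_pos.2 hn)]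
      exact inv_mul_cancel₀ hn.ne')
  obtain ⟨v, -, hv⟩ := (isCompact_closedBall (0 : Y) κ).ultrafilter_le_nhds'
    (U.map fun n => (t n)⁻¹ • (lm n - l0)) (by
      change ∀ᶠ n in (U : Filter ℕ), (t n)⁻¹ • (lm n - l0) ∈ closedBall (0 : Y) κ
      filter_upwards [hmU] with n hn
      rw [mem_closedBall_zero_iff, norm_smul, Real.norm_eq_abs, abs_of_pos (inv_pos.2 hn.1),
        inv_mul_le_iff₀ hn.1, mul_comm]
      exact (le_max_right _ _).trans hn.2)
  have hξ : Tendsto (fun n => (t n)⁻¹ • (x n - x0)) U (𝓝 ξ) := hξ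
  have hv : Tendsto (fun n => (t n)⁻¹ • (lm n - l0)) U (𝓝 v) := hv
  have hρ : ∀ᶠ n in (U : Filter ℕ), max ‖a n‖ ‖b n‖ ≤ t n * (κ * (1 / ((n : ℝ) + 1))) := by
    filter_upwards [hmU] with n hn
    have h1 := (hlt n).le.trans hn.2
    have h2 : (0:ℝ) < (n : ℝ) + 1 := by positivity
    rw [← mul_assoc, mul_one_div, le_div_iff₀ h2]
    linarith
  have hlimκ : Tendsto (fun n : ℕ => κ * (1 / ((n : ℝ) + 1))) U (𝓝 0) := by
    have := (hlim.mono_left hUle).const_mul κ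
    rwa [mul_zero] at this
  have haq : Tendsto (fun n => (t n)⁻¹ • a n) U (𝓝 0) := by
    refine squeeze_zero_norm' ?_ hlimκ
    filter_upwards [hposU, hρ] with n hn h1
    rw [norm_smul, Real.norm_eq_abs, abs_of_pos (inv_pos.2 hn), inv_mul_le_iff₀ hn]
    exact (le_max_left _ _).trans h1
  have hbq : Tendsto (fun n => (t n)⁻¹ • b n) U (𝓝 0) := by
    refine squeeze_zero_norm' ?_ hlimκ
    filter_upwards [hposU, hρ] with n hn h1
    rw [norm_smul, Real.norm_eq_abs, abs_of_pos (inv_pos.2 hn), inv_mul_le_iff₀ hn]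
    exact (le_max_right _ _).trans h1
  have hxeq : ∀ᶠ n in (U : Filter ℕ), x0 + t n • ((t n)⁻¹ • (x n - x0)) = x n := by
    filter_upwards [hposU] with n hn
    rw [smul_smul, mul_inv_cancel₀ hn.ne', one_smul, add_sub_cancel]
  have hx0 : Tendsto x U (𝓝 x0) := by
    have := (tendsto_const_nhds (x := x0)).add
      ((tendsto_nhds_of_tendsto_nhdsWithin htl).smul hξ)
    rw [zero_smul, add_zero] at this
    exact this.congr' hxeq
  have hDg : Continuous fun u => ContinuousLinearMap.adjoint (fderiv ℝ g u) :=
    ContinuousLinearMap.adjoint.continuous.comp (hg.continuous_fderiv (by norm_num))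
  have hst : hessLxx f g x0 l0 ξ + ContinuousLinearMap.adjoint (fderiv ℝ g x0) v = 0 := by
    have e1 := aux_lim hHd htl hξ
    have e2 : Tendsto (fun n => ContinuousLinearMap.adjoint (fderiv ℝ g (x n))
        ((t n)⁻¹ • (lm n - l0))) U (𝓝 (ContinuousLinearMap.adjoint (fderiv ℝ g x0) v)) :=
      clm_tendsto ((hDg.tendsto x0).comp hx0) hv
    refine tendsto_nhds_unique (e1.add e2) (haq.congr' ?_)
    filter_upwards [hxeq] with n hn
    rw [hn, hG0, sub_zero, map_smul, ← smul_add, map_sub]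
    have h1 : gradient f (x n) + ContinuousLinearMap.adjoint (fderiv ℝ g (x n)) (lm n) = a n :=
      (hmem n).1
    rw [← h1]
    congr 1
    abel
  have hgq : Tendsto (fun n => (t n)⁻¹ • (g (x n) - g x0)) U (𝓝 (fderiv ℝ g x0 ξ)) := by
    refine (aux_lim hgd htl hξ).congr' ?_
    filter_upwards [hxeq] with n hn
    rw [hn]
  set h := fderiv ℝ g x0 ξ + v with hh
  have hPq : Tendsto (fun n => (t n)⁻¹ • (projK K (g x0 + l0 + t n • h) - g x0)) U
      (𝓝 (fderiv ℝ g x0 ξ)) := by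
    have e1 : Tendsto (fun n => (t n)⁻¹ • (g (x n) - g x0) - (t n)⁻¹ • b n) U
      (𝓝 (fderiv ℝ g x0 ξ)) := by simpa using hgq.sub hbq
    have e2 : Tendsto (fun n => h - ((t n)⁻¹ • (g (x n) - g x0) - (t n)⁻¹ • b n
        + (t n)⁻¹ • (lm n - l0))) U (𝓝 0) := by
      simpa [hh] using (tendsto_const_nhds (x := h)).sub (e1.add hv)
    have e3 : Tendsto (fun n => (t n)⁻¹ • (projK K (g x0 + l0 + t n • h) - (g (x n) - b n))) U
        (𝓝 0) := by
      refine squeeze_zero_norm' ?_ (by simpa using e2.norm)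
      filter_upwards [hposU] with n hn
      have h1 : projK K (g (x n) - b n + lm n) = g (x n) - b n :=
        projK_eq hKne hKcl hKcv (hmem n).2
      have h2 := projK_lip hKne hKcl hKcv (g x0 + l0 + t n • h) (g (x n) - b n + lm n)
      rw [h1] at h2
      rw [norm_smul]
      refine (mul_le_mul_of_nonneg_left h2 (norm_nonneg _)).trans (le_of_eq ?_)
      rw [← norm_smul]
      congr 1
      have h3 : g x0 + l0 + t n • h - (g (x n) - b n + lm n)
        = t n • h - (g (x n) - g x0 - b n + (lm n - l0)) := by abel
      rw [h3, smul_sub, smul_smul, inv_mul_cancel₀ hn.ne', one_smul, ← smul_sub, ← smul_add]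
    have e4 := e3.add e1
    rw [zero_add] at e4
    refine e4.congr' ?_
    filter_upwards with n
    rw [← smul_sub, ← smul_add]
    congr 1
    abel
  have hdd : HasDirDeriv (projK K) (g x0 + l0) h (fderiv ℝ g x0 ξ) :=
    proj_dirDeriv hKne hKcl hKcv (hKred _ hlam.1) hlam h (l1 := map t U) htl
      (tendsto_map'_iff.2 hPq)
  have hξ0 := hN ξ v hst hdd
  rw [hξ0] at hξs
  simp at hξs

/-- Appendix, Proposition A.2: `S_KKT` is isolated calm at `(0,0)`
for `(x̄,λ̄)` iff `M` is isolated calm at `(x̄,0,0)` for `λ̄` and `λ̄` is noncritical. -/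
theorem stmt_16 (f : X → ℝ) (g : X → Y) (K : Set Y)
    (hf : ContDiff ℝ 2 f) (hg : ContDiff ℝ 2 g)
    (hKne : K.Nonempty) (hKcl : IsClosed K) (hKcv : Convex ℝ K)
    (hKred : C2ConeReducible K)
    (x0 : X) (l0 : Y) (hKKT : (x0, l0) ∈ sKKT f g K 0 0) :
    IsolatedCalm (fun q : X × Y => sKKT f g K q.1 q.2) ((0 : X), (0 : Y)) (x0, l0)
    ↔ (IsolatedCalm (fun q : X × X × Y => mSet f g K q.1 q.2.1 q.2.2) (x0, 0, 0) l0 ∧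
       Noncritical f g K x0 l0) := by
  constructor
  · intro hS
    refine ⟨?_, stmt_fwd f g K hf hg hKne hKcl hKcv x0 l0 hKKT hS⟩
    obtain ⟨κ, ε, δ, hκ, hε, hδ, hS⟩ := hS
    refine ⟨κ, min ε δ, δ, hκ, lt_min hε hδ, hδ, ?_⟩
    rintro ⟨x, a, b⟩ hz l hl hld
    have h1 : ‖x - x0‖ ≤ min ε δ := (norm_fst_le _).trans hz
    have h2 : ‖((a, b) : X × Y) - (0, 0)‖ ≤ ‖((x, a, b) : X × X × Y) - (x0, 0, 0)‖ :=
      norm_snd_le (((x, a, b) : X × X × Y) - (x0, 0, 0))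
    have h3 := hS (a, b) (h2.trans (hz.trans (min_le_left _ _))) (x, l) hl (by
      rw [Prod.mk_sub_mk, Prod.norm_def]
      exact max_le (h1.trans (min_le_right _ _)) hld)
    have h4 : ‖l - l0‖ ≤ ‖((x, l) : X × Y) - (x0, l0)‖ :=
      norm_snd_le (((x, l) : X × Y) - (x0, l0))
    exact h4.trans (h3.trans (mul_le_mul_of_nonneg_left h2 hκ.le))
  · rintro ⟨hM, hN⟩
    exact stmt_bwd f g K hf hg hKne hKcl hKcv hKred x0 l0 hKKT hM hN

end
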